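/- Let μ be a compactly supported absolutely α-friendly measure on ℝ^k, U ⊆ ℝ^k an open set containing supp(μ), and Φ : U → V ⊆ ℝ^k an invertible C² map with nonsingular derivative everywhere. Then for every β < α, the pushforward measure Φ_*μ is absolutely β-friendly. -/

import Mathlib

open MeasureTheory Metric Set
open scoped RealInnerProductSpace

variable {k : ℕ}

/-- The (topological) support of a measure. -/
def msupp {X : Type*} [MetricSpace X] [MeasurableSpace X] (μ : Measure X) : Set X :=
  {x | ∀ ρ > 0, 0 < μ (Metric.ball x ρ)}

/-- `μ` is absolutely `α`-decaying. -/
def AbsDecaying (α : ℝ) (μ : Measure (EuclideanSpace ℝ (Fin k))) : Prop :=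
  ∃ C > (0 : ℝ), ∃ ρ₀ > (0 : ℝ), ∀ x ∈ msupp μ, ∀ ρ : ℝ, 0 < ρ → ρ ≤ ρ₀ →
    ∀ (w : EuclideanSpace ℝ (Fin k)) (t : ℝ), w ≠ 0 → ∀ ε : ℝ, 0 < ε →
      μ (closedBall x ρ ∩ cthickening (ε * ρ) {y | ⟪y, w⟫ = t}) ≤
        ENNReal.ofReal (C * ε ^ α) * μ (closedBall x ρ)

/-- `μ` is Federer (doubling) on its support. -/
def Federer (μ : Measure (EuclideanSpace ℝ (Fin k))) : Prop :=
  ∃ C > (0 : ℝ), ∃ ρ₀ > (0 : ℝ), ∀ x ∈ msupp μ, ∀ ρ : ℝ, 0 < ρ → ρ ≤ ρ₀ →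
    μ (closedBall x (2 * ρ)) ≤ ENNReal.ofReal C * μ (closedBall x ρ)

/-- `μ` is absolutely `α`-friendly: absolutely `α`-decaying and Federer. -/
def AbsFriendly (α : ℝ) (μ : Measure (EuclideanSpace ℝ (Fin k))) : Prop :=
  AbsDecaying α μ ∧ Federer μ

section

variable {μ : Measure (EuclideanSpace ℝ (Fin k))}

theorem measure_compl_msupp (μ : Measure (EuclideanSpace ℝ (Fin k))) : μ (msupp μ)ᶜ = 0 := by
  refine measure_null_of_locally_null _ fun x hx => ?_
  simp only [msupp, mem_compl_iff, mem_ofPred_eq, not_forall, not_lt, nonpos_iff_eq_zero] at hx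
  obtain ⟨ρ, hρ, h⟩ := hx
  exact ⟨ball x ρ, mem_nhdsWithin_of_mem_nhds (ball_mem_nhds x hρ), h⟩

theorem measure_le_of_inter_msupp_subset {A B : Set (EuclideanSpace ℝ (Fin k))}
    (h : A ∩ msupp μ ⊆ B) : μ A ≤ μ B := by
  have hA : A ⊆ B ∪ (msupp μ)ᶜ := fun x hx => by
    by_cases hxs : x ∈ msupp μ
    exacts [.inl (h ⟨hx, hxs⟩), .inr hxs]
  calc μ A ≤ μ B + μ (msupp μ)ᶜ := (measure_mono hA).trans (measure_union_le _ _)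
    _ = μ B := by rw [measure_compl_msupp, add_zero]

theorem cthickening_hyperplane_subset {w : EuclideanSpace ℝ (Fin k)} {t δ : ℝ} (hδ : 0 ≤ δ) :
    cthickening δ {y | ⟪y, w⟫ = t} ⊆ {y | |⟪y, w⟫ - t| ≤ δ * ‖w‖} := by
  have hcl : IsClosed {y : EuclideanSpace ℝ (Fin k) | ⟪y, w⟫ = t} :=
    isClosed_eq (by fun_prop) continuous_const
  rw [hcl.cthickening_eq_biUnion_closedBall hδ]
  intro y hy
  simp only [mem_iUnion, mem_ofPred_eq, mem_closedBall, exists_prop] at hy ⊢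
  obtain ⟨z, rfl, hz⟩ := hy
  rw [← inner_sub_left]
  refine (abs_real_inner_le_norm _ _).trans ?_
  rw [← dist_eq_norm]
  gcongr

theorem subset_cthickening_hyperplane {w : EuclideanSpace ℝ (Fin k)} (hw : w ≠ 0) {t δ : ℝ} :
    {y | |⟪y, w⟫ - t| ≤ δ * ‖w‖} ⊆ cthickening δ {y | ⟪y, w⟫ = t} := by
  intro y hy
  have hw' : 0 < ‖w‖ := norm_pos_iff.2 hw
  refine mem_cthickening_of_dist_le y (y - ((⟪y, w⟫ - t) / ‖w‖ ^ 2) • w) _ _ ?_ ?_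
  · simp only [mem_ofPred_eq, inner_sub_left, inner_smul_left, real_inner_self_eq_norm_sq]
    simp
    field_simp
    ring
  · rw [dist_eq_norm, sub_sub_cancel, norm_smul, Real.norm_eq_abs, abs_div, abs_of_nonneg (sq_nonneg ‖w‖)]
    rw [div_mul_eq_mul_div, div_le_iff₀ (by positivity), sq, ← mul_assoc]
    exact mul_le_mul_of_nonneg_right hy hw'.le

theorem Federer.exists_two_pow (h : Federer μ) (n : ℕ) :
    ∃ C > (0 : ℝ), ∃ ρ₀ > (0 : ℝ), ∀ x ∈ msupp μ, ∀ ρ : ℝ, 0 < ρ → ρ ≤ ρ₀ →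
      μ (closedBall x (2 ^ n * ρ)) ≤ ENNReal.ofReal C * μ (closedBall x ρ) := by
  obtain ⟨C, hC, ρ₀, hρ₀, h⟩ := h
  induction n with
  | zero => exact ⟨1, one_pos, 1, one_pos, by simp⟩
  | succ n ih =>
    obtain ⟨C', hC', ρ₁, hρ₁, ih⟩ := ih
    refine ⟨C' * C, by positivity, min ρ₀ (ρ₁ / 2), by positivity, fun x hx ρ hρ hρ' => ?_⟩
    have h1 : ρ ≤ ρ₀ := hρ'.trans (min_le_left _ _)
    have h2 : 2 * ρ ≤ ρ₁ := by linarith [hρ'.trans (min_le_right _ _)]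
    calc μ (closedBall x (2 ^ (n + 1) * ρ)) = μ (closedBall x (2 ^ n * (2 * ρ))) := by
          rw [pow_succ, mul_assoc]
      _ ≤ ENNReal.ofReal C' * μ (closedBall x (2 * ρ)) := ih x hx _ (by positivity) h2
      _ ≤ ENNReal.ofReal C' * (ENNReal.ofReal C * μ (closedBall x ρ)) := by
          gcongr
          exact h x hx ρ hρ h1
      _ = _ := by rw [ENNReal.ofReal_mul hC'.le, mul_assoc]

/-- If the part of `F` in a ball of radius `r` is close to a hyperplane at the scale `η * r`, then
a density bound for `F` at scale `η * r` improves to one at scale `r`. -/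
theorem AbsFriendly.exists_measure_inter_closedBall_le {α : ℝ} (h : AbsFriendly α μ) :
    ∃ A > (0 : ℝ), ∃ ρ₀ > (0 : ℝ), ∀ (F : Set (EuclideanSpace ℝ (Fin k))), ∀ x ∈ msupp μ,
      ∀ r : ℝ, 0 < r → r ≤ ρ₀ → ∀ η : ℝ, 0 < η → η ≤ 1 → ∀ κ : ENNReal,
      ∀ (w : EuclideanSpace ℝ (Fin k)) (t : ℝ), w ≠ 0 →
      F ∩ closedBall x r ∩ msupp μ ⊆ cthickening (η * r) {y | ⟪y, w⟫ = t} →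
      (∀ y ∈ msupp μ, μ (F ∩ closedBall y (η * r)) ≤ κ * μ (closedBall y (η * r))) →
      μ (F ∩ closedBall x r) ≤ ENNReal.ofReal (A * η ^ α) * κ * μ (closedBall x r) := by
  obtain ⟨⟨C, hC, ρ₁, hρ₁, hdec⟩, hfed⟩ := h
  obtain ⟨C₁, hC₁, ρ₂, hρ₂, hfed₁⟩ := hfed.exists_two_pow 1
  obtain ⟨C₃, hC₃, ρ₃, hρ₃, hfed₃⟩ := hfed.exists_two_pow 3
  refine ⟨C₃ * C * C₁, by positivity, min (ρ₁ / 2) (min ρ₂ ρ₃), by positivity, ?_⟩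
  intro F x hx r hr hr' η hη hη1 κ w t hw hsub hκ
  simp only [le_min_iff] at hr'
  obtain ⟨hr1, hr2, hr3⟩ := hr'
  have hηr : 0 < η * r := by positivity
  have hηr' : η * r ≤ r := by nlinarith
  obtain ⟨u, hut, hdisj, hcov⟩ := Vitali.exists_disjoint_subfamily_covering_enlargement_closedBall
    (F ∩ closedBall x r ∩ msupp μ) id (fun _ => η * r / 8) (η * r / 8) (fun _ _ => le_rfl)
    5 (by norm_num)
  simp only [id] at hdisj hcov
  have hucount : u.Countable := hdisj.countable_of_nonempty_interior fun y _ => by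
    refine ⟨y, ball_subset_interior_closedBall (mem_ball_self (by positivity))⟩
  have hcover : F ∩ closedBall x r ∩ msupp μ ⊆ ⋃ b ∈ u, F ∩ closedBall b (η * r) := by
    intro y hy
    obtain ⟨b, hb, hyb⟩ := hcov y hy
    refine mem_biUnion hb ⟨hy.1.1, closedBall_subset_closedBall ?_
      (hyb (mem_closedBall_self (by positivity)))⟩
    linarith
  have hpack : ⋃ b ∈ u, closedBall b (η * r / 8) ⊆
      closedBall x (2 * r) ∩ cthickening (η * (2 * r)) {y | ⟪y, w⟫ = t} := by
    refine iUnion₂_subset fun b hb y hy => ⟨?_, ?_⟩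
    · have h1 := (hut hb).1.2
      rw [mem_closedBall] at *
      linarith [dist_triangle y b x]
    · have h1 := hsub (hut hb)
      have h2 := cthickening_cthickening_subset (ε := η * r) (δ := η * r) hηr.le hηr.le
        {y | ⟪y, w⟫ = t}
      rw [show η * (2 * r) = η * r + η * r by ring]
      refine h2 (mem_cthickening_of_dist_le y b _ _ h1 ?_)
      rw [mem_closedBall] at hy
      linarith
  calc μ (F ∩ closedBall x r) ≤ μ (⋃ b ∈ u, F ∩ closedBall b (η * r)) :=
        measure_le_of_inter_msupp_subset hcover
    _ ≤ ∑' b : u, μ (F ∩ closedBall b (η * r)) := measure_biUnion_le _ hucount _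
    _ ≤ ∑' b : u, κ * ENNReal.ofReal C₃ * μ (closedBall b (η * r / 8)) := by
        refine ENNReal.tsum_le_tsum fun b => (hκ b (hut b.2).2).trans ?_
        rw [mul_assoc]
        gcongr
        have h8 := hfed₃ b (hut b.2).2 (η * r / 8) (by positivity) (by linarith)
        rwa [show (2 : ℝ) ^ 3 * (η * r / 8) = η * r by ring] at h8
    _ = κ * ENNReal.ofReal C₃ * μ (⋃ b ∈ u, closedBall b (η * r / 8)) := by
        rw [ENNReal.tsum_mul_left, measure_biUnion hucount hdisj
          fun _ _ => isClosed_closedBall.measurableSet]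
    _ ≤ κ * ENNReal.ofReal C₃ *
          (ENNReal.ofReal (C * η ^ α) * (ENNReal.ofReal C₁ * μ (closedBall x r))) := by
        gcongr
        refine (measure_mono hpack).trans ((hdec x hx (2 * r) (by positivity) (by linarith)
          w t hw η hη).trans ?_)
        gcongr
        simpa using hfed₁ x hx r hr hr2
    _ = _ := by
        rw [show C₃ * C * C₁ * η ^ α = C₃ * (C * η ^ α) * C₁ by ring,
          ENNReal.ofReal_mul (p := C₃ * (C * η ^ α)) (by positivity), ENNReal.ofReal_mul hC₃.le]
        ring

/-- A `C¹` map with invertible derivatives is, uniformly on compact sets, close to affine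
isomorphisms of bounded distortion. -/
theorem exists_uniform_linear_approx {E : Type*} [NormedAddCommGroup E] [NormedSpace ℝ E]
    [CompleteSpace E] {K U : Set E} {Φ : E → E} (hK : IsCompact K) (hU : IsOpen U) (hKU : K ⊆ U)
    (hΦ : ContDiffOn ℝ 1 Φ U)
    (hD : ∀ x ∈ U, ∃ D : E ≃L[ℝ] E, HasFDerivAt Φ (D : E →L[ℝ] E) x) :
    ∃ Λ ≥ (1 : ℝ), ∀ δ > (0 : ℝ), ∃ r > (0 : ℝ), ∀ x ∈ K, ∃ D : E ≃L[ℝ] E,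
      (∀ v, ‖D v‖ ≤ Λ * ‖v‖) ∧ (∀ v, ‖D.symm v‖ ≤ Λ * ‖v‖) ∧
      ∀ y ∈ closedBall x r, ‖Φ y - Φ x - D (y - x)‖ ≤ δ * ‖y - x‖ := by
  have hcont : ContinuousOn (fderiv ℝ Φ) K :=
    (hΦ.continuousOn_fderiv_of_isOpen hU le_rfl).mono hKU
  have hcont' : ContinuousOn (fun x => (fderiv ℝ Φ x).inverse) K := fun x hx => by
    obtain ⟨D, hDx⟩ := hD x (hKU hx)
    have h1 : ContinuousAt ContinuousLinearMap.inverse (fderiv ℝ Φ x) := by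
      rw [hDx.fderiv]
      exact (contDiffAt_map_inverse (n := 0) D).continuousAt
    exact h1.comp_continuousWithinAt (hcont x hx)
  obtain ⟨Λ₁, hΛ₁⟩ := hK.exists_bound_of_continuousOn hcont
  obtain ⟨Λ₂, hΛ₂⟩ := hK.exists_bound_of_continuousOn hcont'
  refine ⟨max 1 (max Λ₁ Λ₂), le_max_left _ _, fun δ hδ => ?_⟩
  have hloc : ∀ a : K, ∃ O : Set E, IsOpen O ∧ a.1 ∈ O ∧
      ∀ y ∈ O, ∀ x ∈ O, ‖Φ y - Φ x - fderiv ℝ Φ a (y - x)‖ ≤ δ * ‖y - x‖ := fun a => by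
    have haU : U ∈ nhds a.1 := hU.mem_nhds (hKU a.2)
    have hs : HasStrictFDerivAt Φ (fderiv ℝ Φ a) a.1 :=
      (hΦ.contDiffAt haU).hasStrictFDerivAt one_ne_zero
    obtain ⟨s, hs, h⟩ := hs.approximates_deriv_on_nhds (c := ⟨δ, hδ.le⟩) (Or.inr hδ)
    exact ⟨interior s, isOpen_interior, mem_interior_iff_mem_nhds.2 hs, fun y hy x hx =>
      h y (interior_subset hy) x (interior_subset hx)⟩
  choose O hO haO happ using hloc
  obtain ⟨r, hr, hleb⟩ := lebesgue_number_lemma_of_metric hK hO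
    fun a ha => mem_iUnion.2 ⟨⟨a, ha⟩, haO ⟨a, ha⟩⟩
  refine ⟨r / 2, by positivity, fun x hx => ?_⟩
  obtain ⟨a, ha⟩ := hleb x hx
  obtain ⟨D, hDa⟩ := hD a (hKU a.2)
  have h1 := hΛ₁ a a.2
  have h2 := hΛ₂ a a.2
  have h3 := happ a
  rw [hDa.fderiv] at h1 h2 h3
  rw [ContinuousLinearMap.inverse_equiv] at h2
  refine ⟨D, fun v => ?_, fun v => ?_, fun y hy =>
    h3 y (ha (closedBall_subset_ball (by linarith) hy)) x (ha (mem_ball_self hr))⟩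
  · exact (D : E →L[ℝ] E).le_of_opNorm_le (h1.trans (by simp)) v
  · exact (D.symm : E →L[ℝ] E).le_of_opNorm_le (h2.trans (by simp)) v

/-- An injective map that is uniformly close to affine isomorphisms of bounded distortion is
bi-Lipschitz at small scales on a compact set. -/
theorem exists_bilipschitz_of_linear_approx {E : Type*} [NormedAddCommGroup E] [NormedSpace ℝ E]
    {K : Set E} {Φ : E → E} (hK : IsCompact K) (hΦ : ContinuousOn Φ K) (hinj : InjOn Φ K)
    {Λ : ℝ} (hΛ : 1 ≤ Λ)
    (happ : ∀ δ > (0 : ℝ), ∃ r > (0 : ℝ), ∀ x ∈ K, ∃ D : E ≃L[ℝ] E,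
      (∀ v, ‖D v‖ ≤ Λ * ‖v‖) ∧ (∀ v, ‖D.symm v‖ ≤ Λ * ‖v‖) ∧
      ∀ y ∈ closedBall x r, ‖Φ y - Φ x - D (y - x)‖ ≤ δ * ‖y - x‖) :
    ∃ L ≥ (1 : ℝ), ∃ r > (0 : ℝ), ∀ x ∈ K, ∀ y ∈ K, dist y x ≤ L * dist (Φ y) (Φ x) ∧
      (dist y x ≤ r → dist (Φ y) (Φ x) ≤ L * dist y x) := by
  have hΛ0 : 0 < Λ := by linarith
  obtain ⟨r, hr, happ⟩ := happ (1 / (2 * Λ)) (by positivity)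
  have hsmall : ∀ x ∈ K, ∀ y, dist y x ≤ r →
      dist y x ≤ 2 * Λ * dist (Φ y) (Φ x) ∧ dist (Φ y) (Φ x) ≤ 2 * Λ * dist y x := by
    intro x hx y hy
    obtain ⟨D, h1, h2, h3⟩ := happ x hx
    have h1 := h1 (y - x)
    have h2 := h2 (D (y - x))
    have h3 := h3 y hy
    rw [D.symm_apply_apply] at h2
    have h4 := norm_sub_norm_le (Φ y - Φ x) (D (y - x))
    have h5 := norm_sub_norm_le (D (y - x)) (Φ y - Φ x)
    rw [norm_sub_rev (D (y - x))] at h5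
    have h6 : Λ * (1 / (2 * Λ) * ‖y - x‖) = ‖y - x‖ / 2 := by field_simp
    have h7 : 1 / (2 * Λ) * ‖y - x‖ ≤ Λ * (1 / (2 * Λ) * ‖y - x‖) :=
      le_mul_of_one_le_left (by positivity) hΛ
    have h8 : ‖y - x‖ ≤ Λ * ‖y - x‖ := le_mul_of_one_le_left (norm_nonneg _) hΛ
    simp only [dist_eq_norm]
    constructor
    · have : Λ * ‖D (y - x)‖ ≤ Λ * (‖Φ y - Φ x‖ + 1 / (2 * Λ) * ‖y - x‖) := by
        gcongr
        linarith
      linarith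
    · linarith
  obtain ⟨R, hR⟩ := hK.isBounded.subset_closedBall (0 : E)
  have hcpt : IsCompact ((K ×ˢ K) ∩ {p : E × E | r ≤ dist p.2 p.1}) :=
    (hK.prod hK).inter_right (isClosed_le continuous_const (by fun_prop))
  obtain ⟨c, hc, hcle⟩ := hcpt.exists_forall_le' (f := fun p => ‖Φ p.2 - Φ p.1‖) (a := 0)
    (by
      refine ContinuousOn.mono (s := K ×ˢ K) ?_ inter_subset_left
      exact ((hΦ.comp (t := K) continuousOn_snd fun p hp => hp.2).sub
        (hΦ.comp (t := K) continuousOn_fst fun p hp => hp.1)).norm)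
    (by
      rintro ⟨x, y⟩ ⟨⟨hx, hy⟩, hxy⟩
      refine norm_pos_iff.2 fun h => ?_
      have hyx : y = x := hinj hy hx (sub_eq_zero.1 h)
      simp only [hyx, mem_ofPred_eq, dist_self] at hxy
      linarith)
  refine ⟨max (2 * Λ) (2 * R / c), by linarith [le_max_left (2 * Λ) (2 * R / c)], r, hr,
    fun x hx y hy => ⟨?_, fun h => (hsmall x hx y h).2.trans ?_⟩⟩
  · rcases le_total (dist y x) r with h | h
    · refine (hsmall x hx y h).1.trans ?_
      gcongr
      exact le_max_left _ _
    · have h1 := hcle (x, y) ⟨⟨hx, hy⟩, h⟩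
      rw [← dist_eq_norm] at h1
      have hx0 : dist x 0 ≤ R := hR hx
      have hy0 : dist y 0 ≤ R := hR hy
      have hR0 : 0 ≤ R := dist_nonneg.trans hx0
      calc dist y x ≤ 2 * R := by linarith [dist_triangle_right y x 0]
        _ = 2 * R / c * c := by field_simp
        _ ≤ max (2 * Λ) (2 * R / c) * dist (Φ y) (Φ x) := by
          gcongr
          exact le_max_right _ _
  · gcongr
    exact le_max_left _ _

/-- Preimages of slabs under a map that is uniformly close to affine isomorphisms have small
measure, with any exponent smaller than the decay exponent of the measure. -/
theorem AbsFriendly.exists_measure_preimage_slab_le {α β : ℝ} (h : AbsFriendly α μ)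
    (hβ0 : 0 < β) (hβ : β < α) {Φ : EuclideanSpace ℝ (Fin k) → EuclideanSpace ℝ (Fin k)}
    {Λ : ℝ} (hΛ : 1 ≤ Λ)
    (happ : ∀ δ > (0 : ℝ), ∃ r > (0 : ℝ), ∀ x ∈ msupp μ,
      ∃ D : EuclideanSpace ℝ (Fin k) ≃L[ℝ] EuclideanSpace ℝ (Fin k),
      (∀ v, ‖D v‖ ≤ Λ * ‖v‖) ∧ (∀ v, ‖D.symm v‖ ≤ Λ * ‖v‖) ∧
      ∀ y ∈ closedBall x r, ‖Φ y - Φ x - D (y - x)‖ ≤ δ * ‖y - x‖) :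
    ∃ C > (0 : ℝ), ∃ ρ₀ > (0 : ℝ), ∀ x ∈ msupp μ, ∀ r : ℝ, 0 < r → r ≤ ρ₀ →
      ∀ (w : EuclideanSpace ℝ (Fin k)) (t : ℝ), w ≠ 0 → ∀ ε : ℝ, 0 < ε →
        μ (Φ ⁻¹' {z | |⟪z, w⟫ - t| ≤ ε * r * ‖w‖} ∩ closedBall x r) ≤
          ENNReal.ofReal (C * ε ^ β) * μ (closedBall x r) := by
  have hΛ0 : 0 < Λ := by linarith
  obtain ⟨A, hA, ρ₁, hρ₁, hstep⟩ := h.exists_measure_inter_closedBall_le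
  obtain ⟨η, hη, hη1, hAη⟩ : ∃ η : ℝ, 0 < η ∧ η < 1 ∧ A * η ^ α ≤ η ^ β := by
    have hγ : 0 < α - β := sub_pos.2 hβ
    refine ⟨min (1 / 2) ((A⁻¹) ^ (α - β)⁻¹), by positivity,
      (min_le_left _ _).trans_lt (by norm_num), ?_⟩
    set η := min (1 / 2) ((A⁻¹) ^ (α - β)⁻¹)
    have hη : 0 < η := by positivity
    have h1 : η ^ (α - β) ≤ A⁻¹ := by
      calc η ^ (α - β) ≤ ((A⁻¹) ^ (α - β)⁻¹) ^ (α - β) := by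
            gcongr
            exact min_le_right _ _
        _ = A⁻¹ := Real.rpow_inv_rpow (by positivity) hγ.ne'
    calc A * η ^ α = A * (η ^ (α - β) * η ^ β) := by rw [← Real.rpow_add hη, sub_add_cancel]
      _ ≤ A * (A⁻¹ * η ^ β) := by gcongr
      _ = η ^ β := by field_simp
  obtain ⟨ρ₂, hρ₂, happ⟩ := happ (η / (2 * Λ)) (by positivity)
  have hiter : ∀ (w : EuclideanSpace ℝ (Fin k)) (t s : ℝ), w ≠ 0 → ∀ n : ℕ, ∀ x ∈ msupp μ,
      ∀ r : ℝ, 0 < r → r ≤ min ρ₁ ρ₂ → s ≤ η ^ n * r / (2 * Λ) →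
      μ (Φ ⁻¹' {z | |⟪z, w⟫ - t| ≤ s * ‖w‖} ∩ closedBall x r) ≤
        ENNReal.ofReal ((η ^ β) ^ n) * μ (closedBall x r) := by
    intro w t s hw n
    induction n with
    | zero =>
      intro x _ r _ _ _
      simpa using measure_mono inter_subset_right
    | succ n ih =>
      intro x hx r hr hr' hs
      obtain ⟨hr1, hr2⟩ := le_min_iff.1 hr'
      obtain ⟨D, -, hDsymm, hDapp⟩ := happ x hx
      obtain ⟨w', hadj⟩ : ∃ w', ∀ v, ⟪v, w'⟫ = ⟪D v, w⟫ :=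
        ⟨ContinuousLinearMap.adjoint (D : EuclideanSpace ℝ (Fin k) →L[ℝ] EuclideanSpace ℝ (Fin k)) w,
          fun v => ContinuousLinearMap.adjoint_inner_right _ _ _⟩
      have hww' : ‖w‖ ≤ Λ * ‖w'‖ := by
        have h1 : ‖w‖ * ‖w‖ ≤ Λ * ‖w'‖ * ‖w‖ := by
          calc ‖w‖ * ‖w‖ = ⟪D (D.symm w), w⟫ := by
                rw [D.apply_symm_apply, real_inner_self_eq_norm_mul_norm]
            _ = ⟪D.symm w, w'⟫ := (hadj _).symm
            _ ≤ ‖D.symm w‖ * ‖w'‖ := real_inner_le_norm _ _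
            _ ≤ Λ * ‖w‖ * ‖w'‖ := by
                gcongr
                exact hDsymm w
            _ = _ := by ring
        exact le_of_mul_le_mul_right h1 (norm_pos_iff.2 hw)
      have hw' : w' ≠ 0 := fun h0 => by
        rw [h0, norm_zero, mul_zero] at hww'
        exact hw (norm_le_zero_iff.1 hww')
      have hsη : s ≤ η * r / (2 * Λ) := hs.trans (by
        gcongr
        rw [pow_succ]
        exact mul_le_of_le_one_left hη.le (pow_le_one₀ hη.le hη1.le))
      have hcov : Φ ⁻¹' {z | |⟪z, w⟫ - t| ≤ s * ‖w‖} ∩ closedBall x r ∩ msupp μ ⊆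
          cthickening (η * r) {y | ⟪y, w'⟫ = t - ⟪Φ x, w⟫ + ⟪D x, w⟫} := by
        rintro y ⟨⟨hyF, hyr⟩, -⟩
        apply subset_cthickening_hyperplane hw'
        simp only [mem_preimage, mem_ofPred_eq] at hyF ⊢
        have h1 : ⟪y, w'⟫ - (t - ⟪Φ x, w⟫ + ⟪D x, w⟫) =
            ⟪Φ y, w⟫ - t - ⟪Φ y - Φ x - D (y - x), w⟫ := by
          simp only [hadj, map_sub, inner_sub_left]
          ring
        have h2 := hDapp y (closedBall_subset_closedBall hr2 hyr)
        have h3 : ‖y - x‖ ≤ r := by simpa [dist_eq_norm] using hyr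
        calc |⟪y, w'⟫ - (t - ⟪Φ x, w⟫ + ⟪D x, w⟫)|
            ≤ |⟪Φ y, w⟫ - t| + |⟪Φ y - Φ x - D (y - x), w⟫| := by
              rw [h1]
              exact abs_sub _ _
          _ ≤ η * r / (2 * Λ) * ‖w‖ + η / (2 * Λ) * r * ‖w‖ := by
              refine add_le_add (hyF.trans (by gcongr)) ((abs_real_inner_le_norm _ _).trans ?_)
              gcongr
              exact h2.trans (by gcongr)
          _ = η * r * (‖w‖ / Λ) := by
              field_simp
              ring
          _ ≤ η * r * ‖w'‖ := by
              gcongr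
              rwa [div_le_iff₀' hΛ0]
      refine (hstep _ x hx r hr hr1 η hη hη1.le _ _ _ hw' hcov fun y hy =>
        ih y hy (η * r) (by positivity) ?_ ?_).trans ?_
      · exact (mul_le_of_le_one_left hr.le hη1.le).trans hr'
      · rwa [← mul_assoc, ← pow_succ]
      · gcongr
        rw [← ENNReal.ofReal_mul (by positivity), pow_succ']
        gcongr
  refine ⟨(2 * Λ / η) ^ β, by positivity, min ρ₁ ρ₂, by positivity,
    fun x hx r hr hr' w t hw ε hε => ?_⟩
  rw [← Real.mul_rpow (by positivity) hε.le]
  rcases le_total (2 * Λ * ε) 1 with hε1 | hε1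
  · obtain ⟨n, hn, hn'⟩ := exists_nat_pow_near_of_lt_one (by positivity) hε1 hη hη1
    refine (hiter w t (ε * r) hw n x hx r hr hr' ?_).trans ?_
    · rw [le_div_iff₀ (by positivity)]
      calc ε * r * (2 * Λ) = 2 * Λ * ε * r := by ring
        _ ≤ η ^ n * r := by gcongr
    · rw [← Real.rpow_natCast, ← Real.rpow_mul hη.le, mul_comm β, Real.rpow_mul hη.le,
        Real.rpow_natCast]
      gcongr
      rw [div_mul_eq_mul_div, le_div_iff₀ hη, ← pow_succ]
      exact hn.le
  · have h1 : 1 ≤ 2 * Λ / η * ε := by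
      rw [div_mul_eq_mul_div, le_div_iff₀ hη]
      linarith
    refine (measure_mono inter_subset_right).trans (le_mul_of_one_le_left' ?_)
    rw [ENNReal.one_le_ofReal]
    exact Real.one_le_rpow h1 hβ0.le

theorem msupp_map_subset (hcpt : IsCompact (msupp μ))
    {Φ : EuclideanSpace ℝ (Fin k) → EuclideanSpace ℝ (Fin k)} (hmeas : Measurable Φ)
    (hΦ : ContinuousOn Φ (msupp μ)) : msupp (μ.map Φ) ⊆ Φ '' msupp μ := by
  intro z hz
  by_contra hzn
  obtain ⟨ρ, hρ, hball⟩ := Metric.isOpen_iff.1 (hcpt.image_of_continuousOn hΦ).isClosed.isOpen_compl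
    z hzn
  refine (hz ρ hρ).ne' ?_
  rw [Measure.map_apply hmeas measurableSet_ball]
  exact measure_mono_null (t := (msupp μ)ᶜ)
    (fun x hx hxs => hball hx (mem_image_of_mem Φ hxs)) (measure_compl_msupp μ)

end

/-- Absolute friendliness is preserved under invertible nonsingular `C²`
transformations: if `μ` is compactly supported and absolutely `α`-friendly,
`U ⊇ supp μ` is open and `Φ : U → V` is an invertible `C²` map with everywhere
nonsingular derivative, then `Φ_*μ` is absolutely `β`-friendly for every `β < α`. -/
theorem absFriendly_map (α β : ℝ) (hα : 0 < α) (hβ : β < α) (hβ0 : 0 < β)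
    (μ : Measure (EuclideanSpace ℝ (Fin k))) (hcpt : IsCompact (msupp μ))
    (hfriendly : AbsFriendly α μ)
    (U V : Set (EuclideanSpace ℝ (Fin k))) (hU : IsOpen U) (hUsupp : msupp μ ⊆ U)
    (Φ : EuclideanSpace ℝ (Fin k) → EuclideanSpace ℝ (Fin k))
    (hmeas : Measurable Φ) (hΦV : Φ '' U = V)
    (hinv : ∃ Φinv, Set.InvOn Φinv Φ U V)
    (hC2 : ContDiffOn ℝ 2 Φ U)
    (hnonsing : ∀ x ∈ U, ∃ D : EuclideanSpace ℝ (Fin k) ≃L[ℝ] EuclideanSpace ℝ (Fin k),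
      HasFDerivAt Φ (D : EuclideanSpace ℝ (Fin k) →L[ℝ] EuclideanSpace ℝ (Fin k)) x) :
    AbsFriendly β (Measure.map Φ μ) := by
  have hC1 : ContDiffOn ℝ 1 Φ U := hC2.of_le one_le_two
  have hcont : ContinuousOn Φ (msupp μ) := hC1.continuousOn.mono hUsupp
  obtain ⟨Φinv, hΦinv⟩ := hinv
  have hinj : InjOn Φ (msupp μ) := hΦinv.1.injOn.mono hUsupp
  obtain ⟨Λ, hΛ, happ⟩ := exists_uniform_linear_approx hcpt hU hUsupp hC1 hnonsing
  obtain ⟨L, hL, r₁, hr₁, hlip⟩ := exists_bilipschitz_of_linear_approx hcpt hcont hinj hΛ happ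
  obtain ⟨C, hC, r₂, hr₂, hslab⟩ := hfriendly.exists_measure_preimage_slab_le hβ0 hβ hΛ happ
  obtain ⟨n, hn⟩ := pow_unbounded_of_one_lt (2 * L ^ 2) one_lt_two
  obtain ⟨B, hB, r₃, hr₃, hfed⟩ := hfriendly.2.exists_two_pow n
  have hL0 : 0 < L := by linarith
  have hle : ∀ x ∈ msupp μ, ∀ ρ : ℝ, Φ ⁻¹' closedBall (Φ x) ρ ∩ msupp μ ⊆ closedBall x (L * ρ) :=
    fun x hx ρ y hy => ((hlip x hx y hy.2).1).trans (by gcongr; exact hy.1)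
  have hge : ∀ x ∈ msupp μ, ∀ ρ : ℝ, 0 < ρ → ρ ≤ min r₁ r₃ →
      μ (closedBall x (2 * L * ρ)) ≤ ENNReal.ofReal B * μ.map Φ (closedBall (Φ x) ρ) := by
    intro x hx ρ hρ hρ'
    obtain ⟨h1, h3⟩ := le_min_iff.1 hρ'
    have hρL : ρ / L ≤ ρ := div_le_self hρ.le hL
    rw [Measure.map_apply hmeas isClosed_closedBall.measurableSet]
    calc μ (closedBall x (2 * L * ρ)) ≤ μ (closedBall x (2 ^ n * (ρ / L))) := by
          refine measure_mono (closedBall_subset_closedBall ?_)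
          calc 2 * L * ρ = 2 * L ^ 2 * (ρ / L) := by field_simp
            _ ≤ 2 ^ n * (ρ / L) := by gcongr
      _ ≤ ENNReal.ofReal B * μ (closedBall x (ρ / L)) := hfed x hx _ (by positivity) (by linarith)
      _ ≤ _ := by
          refine mul_le_mul_right ?_ _
          refine measure_le_of_inter_msupp_subset fun y hy => ?_
          have hy1 : dist y x ≤ ρ / L := hy.1
          calc dist (Φ y) (Φ x) ≤ L * dist y x := (hlip x hx y hy.2).2 (by linarith)
            _ ≤ L * (ρ / L) := by gcongr
            _ = ρ := by field_simp
  refine ⟨⟨C * B, by positivity, min (r₂ / L) (min r₁ r₃), by positivity, ?_⟩,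
    ⟨B, hB, min r₁ r₃, by positivity, ?_⟩⟩
  · intro z hz ρ hρ hρ' w t hw ε hε
    obtain ⟨x, hx, rfl⟩ := msupp_map_subset hcpt hmeas hcont hz
    obtain ⟨h2, h13⟩ := le_min_iff.1 hρ'
    rw [le_div_iff₀ hL0] at h2
    rw [Measure.map_apply hmeas (isClosed_closedBall.inter isClosed_cthickening).measurableSet]
    calc μ (Φ ⁻¹' (closedBall (Φ x) ρ ∩ cthickening (ε * ρ) {y | ⟪y, w⟫ = t}))
        ≤ μ (Φ ⁻¹' {z | |⟪z, w⟫ - t| ≤ ε * (L * ρ) * ‖w‖} ∩ closedBall x (L * ρ)) := by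
          refine measure_le_of_inter_msupp_subset fun y hy => ⟨?_, hle x hx ρ ⟨hy.1.1, hy.2⟩⟩
          have hΦy : |⟪Φ y, w⟫ - t| ≤ ε * ρ * ‖w‖ :=
            cthickening_hyperplane_subset (by positivity) hy.1.2
          refine hΦy.trans ?_
          gcongr
          exact le_mul_of_one_le_left hρ.le hL
      _ ≤ ENNReal.ofReal (C * ε ^ β) * μ (closedBall x (L * ρ)) :=
          hslab x hx _ (by positivity) (by linarith) w t hw ε hε
      _ ≤ ENNReal.ofReal (C * ε ^ β) *
            (ENNReal.ofReal B * μ.map Φ (closedBall (Φ x) ρ)) := by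
          gcongr
          refine le_trans ?_ (hge x hx ρ hρ h13)
          gcongr
          linarith
      _ = _ := by
          rw [← mul_assoc, ← ENNReal.ofReal_mul (by positivity), mul_right_comm]
  · intro z hz ρ hρ hρ'
    obtain ⟨x, hx, rfl⟩ := msupp_map_subset hcpt hmeas hcont hz
    refine le_trans ?_ (hge x hx ρ hρ hρ')
    rw [Measure.map_apply hmeas isClosed_closedBall.measurableSet]
    refine measure_le_of_inter_msupp_subset ((hle x hx (2 * ρ)).trans (closedBall_subset_closedBall ?_))
    linarith
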